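/- For every positive integer n, the number of partitions of n into parts not congruent to 0, 12, or 15 modulo 27 equals the number of partitions of n-1 into parts not congruent to 0, 6, or 21 modulo 27 plus the number of partitions of n-2 into parts not congruent to 0, 3, or 24 modulo 27. -/

import Mathlib

/-- `P a n` is the number of partitions of `n` into parts `j` which are not
congruent to `0`, `a`, or `-a` modulo `27`. -/
def P (a n : ℕ) : ℕ :=
  Fintype.card {p : Nat.Partition n //
    ∀ j ∈ p.parts, ¬ (j % 27 = 0 ∨ j % 27 = a % 27 ∨ (j + a) % 27 = 0)}

open Finset PowerSeries Filter Topology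

/-- The Gaussian binomial coefficient `[n, k]_q`, defined through its Pascal recurrence. -/
def qBinom {R : Type*} [CommRing R] (q : R) : ℕ → ℕ → R
  | _, 0 => 1
  | 0, _ + 1 => 0
  | n + 1, k + 1 => qBinom q n (k + 1) + q ^ (n - k) * qBinom q n k

/-- The finite `q`-Pochhammer symbol `(q; q)_n`. -/
def qPoch {R : Type*} [CommRing R] (q : R) (n : ℕ) : R :=
  ∏ i ∈ range n, (1 - q ^ (i + 1))

section qSeries

variable {R : Type*} [CommRing R] (q : R)

theorem qBinom_zero_right (n : ℕ) : qBinom q n 0 = 1 := by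
  cases n <;> rfl

theorem qBinom_succ_succ (n k : ℕ) :
    qBinom q (n + 1) (k + 1) = qBinom q n (k + 1) + q ^ (n - k) * qBinom q n k := rfl

theorem qBinom_eq_zero_of_lt {n k : ℕ} (h : n < k) : qBinom q n k = 0 := by
  induction n generalizing k with
  | zero => obtain ⟨k, rfl⟩ := Nat.exists_eq_add_one_of_ne_zero h.ne'; rfl
  | succ n ih =>
    obtain ⟨k, rfl⟩ := Nat.exists_eq_add_one_of_ne_zero (Nat.ne_zero_of_lt h)
    rw [qBinom_succ_succ, ih (by omega), ih (by omega), mul_zero, add_zero]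

theorem qPoch_succ (n : ℕ) : qPoch q (n + 1) = qPoch q n * (1 - q ^ (n + 1)) :=
  prod_range_succ _ _

theorem qBinom_add_mul_qPoch_mul_qPoch (m k : ℕ) :
    qBinom q (m + k) k * qPoch q k * qPoch q m = qPoch q (m + k) := by
  induction k generalizing m with
  | zero => simp [qBinom_zero_right, qPoch]
  | succ k ihk =>
    induction m with
    | zero =>
      have h := ihk 0
      simp only [zero_add] at h ⊢
      rw [qBinom_succ_succ, qBinom_eq_zero_of_lt q (Nat.lt_succ_self k), qPoch_succ, Nat.sub_self]
      linear_combination (1 - q ^ (k + 1)) * h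
    | succ m ihm =>
      have h := ihk (m + 1)
      rw [show m + 1 + (k + 1) = m + 1 + k + 1 by ring, qBinom_succ_succ,
        show m + 1 + k - k = m + 1 by omega, qPoch_succ q (m + 1 + k), ← h]
      rw [show m + (k + 1) = m + 1 + k by ring, ← h] at ihm
      rw [qPoch_succ q m] at ihm ⊢
      rw [qPoch_succ q k] at ihm ⊢
      linear_combination (1 - q ^ (m + 1)) * ihm

/-- The homogeneous form of the finite `q`-binomial theorem. -/
theorem prod_add_mul_pow_eq_sum_qBinom (u v : R) (n : ℕ) :
    ∏ i ∈ range n, (u + v * q ^ i) =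
      ∑ k ∈ range (n + 1), q ^ (k.choose 2) * qBinom q n k * u ^ (n - k) * v ^ k := by
  induction n with
  | zero => simp [qBinom_zero_right]
  | succ n ih =>
    have hterm : ∀ k ∈ range (n + 1),
        q ^ ((k + 1).choose 2) * qBinom q (n + 1) (k + 1) * u ^ (n + 1 - (k + 1)) * v ^ (k + 1) =
          u * (q ^ ((k + 1).choose 2) * qBinom q n (k + 1) * u ^ (n - (k + 1)) * v ^ (k + 1)) +
          v * q ^ n * (q ^ (k.choose 2) * qBinom q n k * u ^ (n - k) * v ^ k) := by
      intro k hk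
      have hkn : k ≤ n := Nat.lt_succ_iff.mp (mem_range.mp hk)
      rw [qBinom_succ_succ, Nat.add_sub_add_right, Nat.choose_succ_succ' k 1, Nat.choose_one_right]
      obtain ⟨d, rfl⟩ := Nat.exists_eq_add_of_le hkn
      rcases d with _ | d
      · rw [qBinom_eq_zero_of_lt q (Nat.lt_succ_self _)]
        simp only [add_zero, Nat.sub_self]
        ring
      · rw [show k + (d + 1) - k = d + 1 by omega, show k + (d + 1) - (k + 1) = d by omega]
        ring
    rw [prod_range_succ, ih, sum_range_succ' _ (n + 1), sum_congr rfl hterm, sum_add_distrib,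
      ← mul_sum, ← mul_sum]
    have hshift := sum_range_succ'
      (fun k ↦ q ^ (k.choose 2) * qBinom q n k * u ^ (n - k) * v ^ k) (n + 1)
    rw [sum_range_succ, qBinom_eq_zero_of_lt q (Nat.lt_succ_self n)] at hshift
    simp only [qBinom_zero_right, Nat.sub_zero, Nat.choose_zero_succ, pow_zero, mul_zero,
      zero_mul, add_zero, one_mul, mul_one] at hshift ⊢
    linear_combination u * hshift

theorem pow_succ_dvd_qPoch_sub_qPoch {r s : ℕ} (h : r ≤ s) :
    q ^ (r + 1) ∣ qPoch q s - qPoch q r := by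
  induction s, h using Nat.le_induction with
  | base => simp
  | succ s hrs ih =>
    have : qPoch q (s + 1) - qPoch q r = qPoch q s - qPoch q r - q ^ (s + 1) * qPoch q s := by
      rw [qPoch_succ]; ring
    rw [this]
    exact dvd_sub ih ((pow_dvd_pow q (by omega)).mul_right _)

theorem pow_succ_dvd_qPoch_mul_qBinom_sub_one {m k r N : ℕ} (hu : IsUnit (qPoch q r))
    (hr : (r = m ∧ r ≤ k) ∨ (r = k ∧ r ≤ m)) (hN : r ≤ N) :
    q ^ (r + 1) ∣ qPoch q N * qBinom q (m + k) k - 1 := by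
  obtain ⟨s, hrs, hs⟩ : ∃ s, r ≤ s ∧
      qBinom q (m + k) k * qPoch q r * qPoch q s = qPoch q (m + k) := by
    rcases hr with ⟨rfl, h⟩ | ⟨rfl, h⟩
    · exact ⟨k, h, by rw [← qBinom_add_mul_qPoch_mul_qPoch]; ring⟩
    · exact ⟨m, h, qBinom_add_mul_qPoch_mul_qPoch q m r⟩
  rw [← hu.dvd_mul_left]
  have hrmk : r ≤ m + k := by omega
  have hsplit : qPoch q r * (qPoch q N * qBinom q (m + k) k - 1) =
      qBinom q (m + k) k * qPoch q r * ((qPoch q N - qPoch q r) - (qPoch q s - qPoch q r)) +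
        (qPoch q (m + k) - qPoch q r) := by
    rw [← hs]; ring
  rw [hsplit]
  exact dvd_add ((dvd_sub (pow_succ_dvd_qPoch_sub_qPoch q hN)
    (pow_succ_dvd_qPoch_sub_qPoch q hrs)).mul_left _) (pow_succ_dvd_qPoch_sub_qPoch q hrmk)

end qSeries

/-- The exponent `b * j * (j - 1) / 2 + a * j` of the theta series. -/
def thetaExp (b a : ℕ) (j : ℤ) : ℕ := (b * (j * (j - 1) / 2) + a * j).toNat

theorem two_mul_natCast_thetaExp {b a : ℕ} (hab : a ≤ b) (j : ℤ) :
    2 * (thetaExp b a j : ℤ) = b * (j * (j - 1)) + 2 * a * j := by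
  have heven : 2 * (j * (j - 1) / 2) = j * (j - 1) :=
    Int.two_mul_ediv_two_of_even (by simpa [mul_comm] using Int.even_mul_pred_self j)
  have hb : (a : ℤ) ≤ b := by exact_mod_cast hab
  have hnonneg : 0 ≤ (b : ℤ) * (j * (j - 1) / 2) + a * j := by
    rcases le_or_gt 0 j with hj | hj
    · have : 0 ≤ j * (j - 1) / 2 := by
        rcases hj.eq_or_lt with rfl | hj
        · simp
        · have : 0 ≤ j * (j - 1) := mul_nonneg hj.le (by omega)
          omega
      positivity
    · have h1 : 0 ≤ j * (j - 1) / 2 + j := by nlinarith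
      nlinarith [mul_nonneg (sub_nonneg.mpr hb) (neg_nonneg.mpr hj.le),
        mul_nonneg (Int.natCast_nonneg b) h1]
  rw [thetaExp, Int.toNat_of_nonneg hnonneg, mul_add, mul_left_comm, heven]
  ring

theorem natAbs_le_thetaExp {b a : ℕ} (ha : 0 < a) (hab : a < b) (j : ℤ) :
    j.natAbs ≤ thetaExp b a j := by
  have h := two_mul_natCast_thetaExp hab.le j
  have ha' : (1 : ℤ) ≤ a := by exact_mod_cast ha
  have hb : (a : ℤ) + 1 ≤ b := by exact_mod_cast hab
  zify
  rcases le_or_gt 0 j with hj | hj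
  · rw [abs_of_nonneg hj]
    have : 0 ≤ (b : ℤ) * (j * (j - 1)) := by
      rcases hj.eq_or_lt with rfl | hj
      · simp
      · exact mul_nonneg (by positivity) (mul_nonneg hj.le (by omega))
    nlinarith
  · rw [abs_of_neg hj]
    obtain ⟨i, rfl⟩ : ∃ i : ℤ, j = -i := ⟨-j, by ring⟩
    have hi : 1 ≤ i := by omega
    nlinarith [mul_nonneg (sub_nonneg.mpr hb) (by omega : 0 ≤ i),
      mul_nonneg (by positivity : (0 : ℤ) ≤ b) (mul_nonneg (by omega : 0 ≤ i) (sub_nonneg.mpr hi))]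

theorem isUnit_qPoch_X_pow {b : ℕ} (hb : 0 < b) (n : ℕ) :
    IsUnit (qPoch ((X : ℤ⟦X⟧) ^ b) n) := by
  rw [PowerSeries.isUnit_iff_constantCoeff, qPoch, map_prod]
  simp [hb.ne']

theorem intCast_negOnePow_sub (k N : ℕ) :
    ((((k : ℤ) - N).negOnePow : ℤ) : ℤ⟦X⟧) = (-1) ^ (N + k) := by
  rw [Int.negOnePow_sub]
  simp [Int.coe_negOnePow, pow_add, mul_comm]

theorem choose_two_mul_add_eq {b a : ℕ} (hab : a ≤ b) {N k : ℕ} (hN : 0 < N) (hk : k ≤ 2 * N) :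
    b * k.choose 2 + (b * N - a) * (2 * N - k) =
      (b * N - a) * N + b * N.choose 2 + thetaExp b a ((k : ℤ) - N) := by
  have h := two_mul_natCast_thetaExp hab ((k : ℤ) - N)
  have haN : a ≤ b * N := hab.trans (Nat.le_mul_of_pos_right b hN)
  have hchoose : ∀ m : ℕ, 2 * (m.choose 2 : ℤ) = m * (m - 1) := by
    intro m
    rcases m with _ | m
    · simp
    · have h2 := sum_range_id_mul_two (m + 1)
      rw [sum_range_id, ← Nat.choose_two_right, Nat.add_sub_cancel] at h2
      zify at h2
      push_cast
      linarith
  zify [haN, hk]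
  have h1 := hchoose k
  have h2 := hchoose N
  refine mul_left_cancel₀ (two_ne_zero' ℤ) ?_
  linear_combination (b : ℤ) * h1 - b * h2 - h

/-- The finite form of the Jacobi triple product identity. -/
theorem prod_one_sub_X_pow_eq_sum_qBinom {b a : ℕ} (hab : a ≤ b) (N : ℕ) :
    ∏ m ∈ range N, ((1 - X ^ (b * m + a)) * (1 - X ^ (b * m + (b - a))) : ℤ⟦X⟧) =
      ∑ k ∈ range (2 * N + 1), (((k : ℤ) - N).negOnePow : ℤ⟦X⟧) *
        X ^ thetaExp b a ((k : ℤ) - N) * qBinom (X ^ b) (2 * N) k := by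
  rcases Nat.eq_zero_or_pos N with rfl | hN
  · simp [thetaExp, qBinom_zero_right]
  have haN : a ≤ b * N := hab.trans (Nat.le_mul_of_pos_right b hN)
  have hne : (X : ℤ⟦X⟧) ^ ((b * N - a) * N + b * N.choose 2) ≠ 0 := pow_ne_zero _ X_ne_zero
  refine mul_left_cancel₀ hne ?_
  have hupper : ∏ i ∈ range N, ((X : ℤ⟦X⟧) ^ (b * N - a) + -1 * (X ^ b) ^ (N + i)) =
      X ^ ((b * N - a) * N) * ∏ m ∈ range N, (1 - X ^ (b * m + a)) := by
    rw [pow_mul, ← card_range N, ← prod_const, card_range, ← prod_mul_distrib]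
    refine prod_congr rfl fun m _ ↦ ?_
    rw [mul_sub, mul_one, ← pow_add, ← pow_mul,
      show b * N - a + (b * m + a) = b * (N + m) by rw [mul_add]; omega]
    ring
  have hlower : ∏ i ∈ range N, ((X : ℤ⟦X⟧) ^ (b * N - a) + -1 * (X ^ b) ^ i) =
      (-1) ^ N * X ^ (b * N.choose 2) * ∏ m ∈ range N, (1 - X ^ (b * m + (b - a))) := by
    have hpow : (X : ℤ⟦X⟧) ^ (b * N.choose 2) = ∏ m ∈ range N, (X ^ b) ^ (N - 1 - m) := by
      rw [prod_range_reflect (fun m ↦ ((X : ℤ⟦X⟧) ^ b) ^ m), prod_pow_eq_pow_sum, sum_range_id,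
        ← Nat.choose_two_right, pow_mul]
    have hneg : (-1 : ℤ⟦X⟧) ^ N = ∏ _m ∈ range N, -1 := by simp
    rw [hpow, hneg, ← prod_range_reflect, ← prod_mul_distrib, ← prod_mul_distrib]
    refine prod_congr rfl fun m hm ↦ ?_
    have hexp : b * N - a = b * (N - 1 - m) + (b * m + (b - a)) := by
      have hm' := mem_range.mp hm
      obtain ⟨d, rfl⟩ : ∃ d, N = m + 1 + d := Nat.exists_eq_add_of_le hm'
      rw [show m + 1 + d - 1 - m = d by omega, mul_add, mul_add]
      omega
    rw [hexp, pow_add, pow_mul]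
    ring
  have hsign : ((-1 : ℤ⟦X⟧) ^ N) * (-1) ^ N = 1 := by rw [← mul_pow]; simp
  have h := prod_add_mul_pow_eq_sum_qBinom ((X : ℤ⟦X⟧) ^ b) (X ^ (b * N - a)) (-1) (2 * N)
  rw [two_mul, prod_range_add, hupper, hlower, ← two_mul] at h
  rw [prod_mul_distrib, mul_sum]
  calc _ = (-1) ^ N * ∑ k ∈ range (2 * N + 1), ((X : ℤ⟦X⟧) ^ b) ^ k.choose 2 *
        qBinom (X ^ b) (2 * N) k * (X ^ (b * N - a)) ^ (2 * N - k) * (-1) ^ k := by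
        rw [← h, pow_add]
        linear_combination (-X ^ ((b * N - a) * N) * X ^ (b * N.choose 2) *
          (∏ m ∈ range N, (1 - X ^ (b * m + a))) *
          ∏ m ∈ range N, (1 - X ^ (b * m + (b - a)))) * hsign
    _ = _ := by
        rw [mul_sum]
        refine sum_congr rfl fun k hk ↦ ?_
        have hexp := choose_two_mul_add_eq hab hN (Nat.lt_succ_iff.mp (mem_range.mp hk))
        rw [intCast_negOnePow_sub, ← pow_mul, ← pow_mul]
        have := congrArg ((X : ℤ⟦X⟧) ^ ·) hexp
        simp only [pow_add] at this ⊢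
        linear_combination ((-1) ^ N * (-1) ^ k * qBinom (X ^ b) (2 * N) k) * this

theorem X_pow_dvd_jacobi_partial_sub {b a : ℕ} (ha : 0 < a) (hab : a < b) (N : ℕ) :
    (X : ℤ⟦X⟧) ^ (N + 1) ∣
      ∏ m ∈ range N, ((1 - X ^ (b * m + a)) * (1 - X ^ (b * m + (b - a))) *
        (1 - X ^ (b * m + b))) -
      ∑ k ∈ range (2 * N + 1), (((k : ℤ) - N).negOnePow : ℤ⟦X⟧) *
        X ^ thetaExp b a ((k : ℤ) - N) := by
  have hpoch : ∏ m ∈ range N, (1 - (X : ℤ⟦X⟧) ^ (b * m + b)) = qPoch (X ^ b) N :=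
    prod_congr rfl fun m _ ↦ by rw [← pow_mul, mul_add, mul_one]
  rw [prod_mul_distrib, hpoch, prod_one_sub_X_pow_eq_sum_qBinom hab.le, sum_mul,
    ← sum_sub_distrib]
  refine dvd_sum fun k hk ↦ ?_
  have hk' : k ≤ 2 * N := Nat.lt_succ_iff.mp (mem_range.mp hk)
  obtain ⟨m, hm⟩ : ∃ m, 2 * N = m + k := ⟨2 * N - k, by omega⟩
  obtain ⟨r, hr, hrN, hrj⟩ : ∃ r, ((r = m ∧ r ≤ k) ∨ (r = k ∧ r ≤ m)) ∧ r ≤ N ∧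
      r + ((k : ℤ) - N).natAbs = N := by
    rcases le_total m k with h | h
    · exact ⟨m, Or.inl ⟨rfl, h⟩, by omega, by omega⟩
    · exact ⟨k, Or.inr ⟨rfl, h⟩, by omega, by omega⟩
  have hb : 0 < b := by omega
  have hq := pow_succ_dvd_qPoch_mul_qBinom_sub_one ((X : ℤ⟦X⟧) ^ b) (isUnit_qPoch_X_pow hb r) hr hrN
  rw [← hm] at hq
  have hX : (X : ℤ⟦X⟧) ^ (r + 1) ∣ qPoch (X ^ b) N * qBinom (X ^ b) (2 * N) k - 1 := by
    refine dvd_trans ?_ hq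
    rw [← pow_mul]
    exact pow_dvd_pow _ (Nat.le_mul_of_pos_left _ hb)
  have hXj : (X : ℤ⟦X⟧) ^ ((k : ℤ) - N).natAbs ∣ X ^ thetaExp b a ((k : ℤ) - N) :=
    pow_dvd_pow _ (natAbs_le_thetaExp ha hab _)
  have hmul := (mul_dvd_mul hXj hX).mul_left (((k : ℤ) - N).negOnePow : ℤ⟦X⟧)
  rw [← pow_add, ← add_assoc, add_comm _ r, hrj] at hmul
  convert hmul using 1
  ring

open scoped PowerSeries.WithPiTopology

theorem tendsto_zero_of_X_pow_dvd {f : ℕ → ℤ⟦X⟧} (h : ∀ N, X ^ (N + 1) ∣ f N) :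
    Tendsto f atTop (𝓝 0) := by
  rw [WithPiTopology.tendsto_iff_coeff_tendsto]
  refine fun d ↦ tendsto_atTop_of_eventually_const (i₀ := d) fun N hN ↦ ?_
  rw [map_zero]
  exact X_pow_dvd_iff.mp (h N) d (by omega)

/-- A limit form of the **Jacobi triple product** identity: the symmetric partial sums of the theta
series converge to the limit of the partial products. -/
theorem tendsto_sum_thetaExp {b a : ℕ} (ha : 0 < a) (hab : a < b) {L : ℤ⟦X⟧}
    (hL : Tendsto (fun N ↦ ∏ m ∈ range N, ((1 - (X : ℤ⟦X⟧) ^ (b * m + a)) *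
      (1 - X ^ (b * m + (b - a))) * (1 - X ^ (b * m + b)))) atTop (𝓝 L)) :
    Tendsto (fun N : ℕ ↦ ∑ k ∈ range (2 * N + 1), (((k : ℤ) - N).negOnePow : ℤ⟦X⟧) *
      X ^ thetaExp b a ((k : ℤ) - N)) atTop (𝓝 L) := by
  have h := hL.sub (tendsto_zero_of_X_pow_dvd (X_pow_dvd_jacobi_partial_sub ha hab))
  simpa using h

/-- The generating function of partitions all of whose parts satisfy `p`. -/
noncomputable def restrictedSeries (p : ℕ → Prop) [DecidablePred p] : ℤ⟦X⟧ :=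
  PowerSeries.mk fun n ↦ (#(Nat.Partition.restricted n p) : ℤ)

theorem hasProd_restrictedSeries_mul_pentagonalSeries (p : ℕ → Prop) [DecidablePred p] :
    HasProd (fun i ↦ if p (i + 1) then (1 : ℤ⟦X⟧) else 1 - X ^ (i + 1))
      (restrictedSeries p * pentagonalSeries ℤ) := by
  have h := (Nat.Partition.hasProd_powerSeriesMk_card_restricted ℤ p).mul
    (WithPiTopology.hasProd_one_sub_X_pow ℤ)
  refine h.congr_fun fun i ↦ ?_
  split_ifs
  · simp_rw [pow_mul]
    rw [WithPiTopology.tsum_pow_mul_one_sub_of_constantCoeff_eq_zero (by simp)]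
  · simp

theorem prod_range_mul_eq_prod_prod {M : Type*} [CommMonoid M] (f : ℕ → M) (b N : ℕ) :
    ∏ i ∈ range (b * N), f i = ∏ m ∈ range N, ∏ i ∈ range b, f (b * m + i) := by
  induction N with
  | zero => simp
  | succ N ih => rw [mul_add_one, prod_range_add, ih, prod_range_succ]

/-- The condition on the parts of the partitions counted by `P a`. -/
abbrev IsAdmissiblePart (a j : ℕ) : Prop :=
  ¬ (j % 27 = 0 ∨ j % 27 = a % 27 ∨ (j + a) % 27 = 0)

theorem tendsto_sum_thetaExp_restrictedSeries {a : ℕ} (ha : 0 < a) (ha' : a < 27) :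
    Tendsto (fun N : ℕ ↦ ∑ k ∈ range (2 * N + 1), (((k : ℤ) - N).negOnePow : ℤ⟦X⟧) *
      X ^ thetaExp 27 a ((k : ℤ) - N)) atTop
      (𝓝 (restrictedSeries (IsAdmissiblePart a) * pentagonalSeries ℤ)) := by
  apply tendsto_sum_thetaExp ha ha'
  have h := (hasProd_restrictedSeries_mul_pentagonalSeries (IsAdmissiblePart a)).tendsto_prod_nat
  have hmul : Tendsto (fun N : ℕ ↦ 27 * N) atTop atTop :=
    tendsto_id.const_mul_atTop' (by norm_num)
  refine (h.comp hmul).congr fun N ↦ ?_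
  rw [Function.comp_apply, prod_range_mul_eq_prod_prod]
  refine prod_congr rfl fun m _ ↦ ?_
  have hfilter : {i ∈ range 27 | ¬ IsAdmissiblePart a (27 * m + i + 1)} =
      {a - 1, 27 - a - 1, 26} := by
    ext i
    simp only [IsAdmissiblePart, mem_filter, mem_range, mem_insert, mem_singleton]
    omega
  simp_rw [← ite_not (IsAdmissiblePart a _), ← prod_filter]
  rw [hfilter, prod_insert (by simp only [mem_insert, mem_singleton]; omega),
    prod_insert (by simp only [mem_singleton]; omega), prod_singleton, ← mul_assoc]
  rw [show 27 * m + (a - 1) + 1 = 27 * m + a by omega,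
    show 27 * m + (27 - a - 1) + 1 = 27 * m + (27 - a) by omega]

theorem HasSum.tendsto_sum_range_symmetric {M : Type*} [AddCommMonoid M] [TopologicalSpace M]
    {f : ℤ → M} {s : M} (h : HasSum f s) :
    Tendsto (fun N : ℕ ↦ ∑ k ∈ range (2 * N + 1), f ((k : ℤ) - N)) atTop (𝓝 s) := by
  have hIcc : Tendsto (fun N : ℕ ↦ Finset.Icc (-(N : ℤ)) N) atTop atTop := by
    refine tendsto_atTop_finset_of_monotone (fun m n hmn ↦ ?_) fun x ↦ ⟨x.natAbs, ?_⟩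
    · exact Icc_subset_Icc (by omega) (by omega)
    · rw [mem_Icc]; omega
  refine (Tendsto.comp h hIcc).congr fun N ↦ ?_
  refine (sum_nbij' (fun k : ℕ ↦ (k : ℤ) - N) (fun j ↦ (j + N).toNat) ?_ ?_ ?_ ?_ ?_).symm
  all_goals
    intro x hx
    simp only [mem_range, mem_Icc] at *
    try omega

theorem sum_range_three_mul {M : Type*} [AddCommMonoid M] (f : ℕ → M) (n : ℕ) :
    ∑ k ∈ range (3 * n), f k =
      ∑ i ∈ range n, (f (3 * i) + f (3 * i + 1) + f (3 * i + 2)) := by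
  induction n with
  | zero => simp
  | succ n ih =>
    rw [mul_add_one, sum_range_succ, sum_range_succ, sum_range_succ, ih, sum_range_succ]
    simp only [add_assoc]

theorem pentagonal_three_mul (j : ℤ) : pentagonal (3 * j) = thetaExp 27 12 j := by
  have h1 := two_mul_natCast_pentagonal (3 * j)
  have h2 := two_mul_natCast_thetaExp (show 12 ≤ 27 by norm_num) j
  zify
  push_cast at h1 h2
  linarith

theorem pentagonal_three_mul_add_one (j : ℤ) :
    pentagonal (3 * j + 1) = 1 + thetaExp 27 21 j := by
  have h1 := two_mul_natCast_pentagonal (3 * j + 1)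
  have h2 := two_mul_natCast_thetaExp (show 21 ≤ 27 by norm_num) j
  zify
  push_cast at h1 h2
  linarith

theorem pentagonal_three_mul_sub_one (j : ℤ) :
    pentagonal (3 * j - 1) = 2 + thetaExp 27 3 j := by
  have h1 := two_mul_natCast_pentagonal (3 * j - 1)
  have h2 := two_mul_natCast_thetaExp (show 3 ≤ 27 by norm_num) j
  zify
  push_cast at h1 h2
  linarith

theorem negOnePow_three_mul (j : ℤ) : (3 * j).negOnePow = j.negOnePow := by
  rw [Int.negOnePow_eq_iff]
  exact ⟨j, by ring⟩

theorem sum_pentagonal_eq_sum_thetaExp (N : ℕ) :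
    ∑ k ∈ range (2 * (3 * N + 1) + 1), (((k : ℤ) - (3 * N + 1 : ℕ)).negOnePow : ℤ⟦X⟧) *
        X ^ pentagonal ((k : ℤ) - (3 * N + 1 : ℕ)) =
      ∑ k ∈ range (2 * N + 1), (((k : ℤ) - N).negOnePow : ℤ⟦X⟧) *
        X ^ thetaExp 27 12 ((k : ℤ) - N) -
      X * ∑ k ∈ range (2 * N + 1), (((k : ℤ) - N).negOnePow : ℤ⟦X⟧) *
        X ^ thetaExp 27 21 ((k : ℤ) - N) -
      X ^ 2 * ∑ k ∈ range (2 * N + 1), (((k : ℤ) - N).negOnePow : ℤ⟦X⟧) *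
        X ^ thetaExp 27 3 ((k : ℤ) - N) := by
  rw [show 2 * (3 * N + 1) + 1 = 3 * (2 * N + 1) by ring, sum_range_three_mul, mul_sum, mul_sum,
    ← sum_sub_distrib, ← sum_sub_distrib]
  refine sum_congr rfl fun i _ ↦ ?_
  have h0 : ((3 * i : ℕ) : ℤ) - (3 * N + 1 : ℕ) = 3 * ((i : ℤ) - N) - 1 := by push_cast; ring
  have h1 : ((3 * i + 1 : ℕ) : ℤ) - (3 * N + 1 : ℕ) = 3 * ((i : ℤ) - N) := by push_cast; ring
  have h2 : ((3 * i + 2 : ℕ) : ℤ) - (3 * N + 1 : ℕ) = 3 * ((i : ℤ) - N) + 1 := by push_cast; ring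
  rw [h0, h1, h2, pentagonal_three_mul, pentagonal_three_mul_add_one, pentagonal_three_mul_sub_one,
    Int.negOnePow_sub, Int.negOnePow_add, negOnePow_three_mul, pow_add, pow_add]
  simp only [Int.negOnePow_one, Units.val_mul, Units.val_neg, Units.val_one, Int.cast_mul,
    Int.cast_neg, Int.cast_one]
  ring

theorem restrictedSeries_identity :
    restrictedSeries (IsAdmissiblePart 12) - X * restrictedSeries (IsAdmissiblePart 6) -
      X ^ 2 * restrictedSeries (IsAdmissiblePart 3) = 1 := by
  have h6 : restrictedSeries (IsAdmissiblePart 6) = restrictedSeries (IsAdmissiblePart 21) := by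
    have hiff : ∀ j, IsAdmissiblePart 6 j ↔ IsAdmissiblePart 21 j := fun j ↦ by
      rw [IsAdmissiblePart, IsAdmissiblePart]
      omega
    simp_rw [restrictedSeries, Nat.Partition.restricted, hiff]
  have hpent := (WithPiTopology.hasSum_pentagonalSeries ℤ).tendsto_sum_range_symmetric
  have hsub : Tendsto (fun N : ℕ ↦ 3 * N + 1) atTop atTop :=
    tendsto_atTop_mono (fun N ↦ by simp only [id]; omega) tendsto_id
  have hlim := ((tendsto_sum_thetaExp_restrictedSeries (a := 12) (by simp) (by simp)).sub
    ((tendsto_sum_thetaExp_restrictedSeries (a := 21) (by simp) (by simp)).const_mul X)).sub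
    ((tendsto_sum_thetaExp_restrictedSeries (a := 3) (by simp) (by simp)).const_mul (X ^ 2))
  have heq := tendsto_nhds_unique (hlim.congr fun N ↦ (sum_pentagonal_eq_sum_thetaExp N).symm)
    (hpent.comp hsub)
  have hne : pentagonalSeries ℤ ≠ 0 := by
    intro h
    have h0 := coeff_pentagonalSeries_pentagonal ℤ 0
    simp [h] at h0
  rw [h6]
  exact mul_right_cancel₀ hne (by linear_combination heq)

theorem coeff_restrictedSeries_eq_P (a n : ℕ) :
    (restrictedSeries (IsAdmissiblePart a)).coeff n = (P a n : ℤ) := by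
  rw [restrictedSeries, coeff_mk, P, Fintype.card_subtype]
  rfl

/-- For every positive integer `n`,
`P₂₇(12; n) = P₂₇(6; n-1) + P₂₇(3; n-2)`, where a term with negative
argument is interpreted as `0`. -/
theorem andrews_gordon_shifted_partition_identity (n : ℕ) (hn : 1 ≤ n) :
    P 12 n = P 6 (n - 1) + (if 2 ≤ n then P 3 (n - 2) else 0) := by
  have h := congrArg (fun f : ℤ⟦X⟧ ↦ f.coeff n) restrictedSeries_identity
  obtain ⟨n, rfl⟩ := Nat.exists_eq_add_of_le' hn
  simp only [map_sub, coeff_succ_X_mul, coeff_X_pow_mul', coeff_restrictedSeries_eq_P,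
    coeff_one, Nat.succ_ne_zero, if_false] at h
  rw [Nat.add_sub_cancel]
  split_ifs at h ⊢ <;> omega
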